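/- Let n, m be coprime integers and X₀ ∈ ℝ × ℝ, and suppose the line {X₀ + t • ((n : ℝ), (m : ℝ)) : t ∈ ℝ} contains no knot (no point with both coordinates in (1/2) • ℤ). Then for all s, t ∈ [0,1), if there exist ε ∈ ({1, -1} : Set ℝ) and u ∈ ℤ × ℤ with X₀ + t • ((n : ℝ), (m : ℝ)) = ε • (X₀ + s • ((n : ℝ), (m : ℝ))) + ((u.1 : ℝ), (u.2 : ℝ)), then s = t. (Hence the segment from X₀ to X₀ + (n, m) projects to a simple closed geodesic on the disphenoid.) -/

import Mathlib

/-- A real number is a half-integer if it equals `k/2` for some integer `k`. -/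
def IsHalfInt (x : ℝ) : Prop := ∃ k : ℤ, x = k / 2

/-- A point of `ℝ²` is a knot of the full net of the disphenoid if both of its
coordinates are half-integers. -/
def IsKnot (p : ℝ × ℝ) : Prop := IsHalfInt p.1 ∧ IsHalfInt p.2

/-- If a line in `ℝ²` with coprime integer direction `(n, m)` contains no knot,
then the natural parameters in `[0,1)` of any two points of the line that are
identified on the disphenoid (i.e. differ by `x ↦ ε x + u`, `ε = ±1`, `u ∈ ℤ²`)
coincide; hence the segment from `X₀` to `X₀ + (n, m)` projects to a simple
closed geodesic on the disphenoid. -/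
theorem line_projects_to_simple_geodesic
    (n m : ℤ) (hco : IsCoprime n m) (X₀ : ℝ × ℝ)
    (hline : ∀ t : ℝ, ¬ IsKnot (X₀ + t • ((n : ℝ), (m : ℝ)))) :
    ∀ s ∈ Set.Ico (0 : ℝ) 1, ∀ t ∈ Set.Ico (0 : ℝ) 1,
      (∃ ε ∈ ({1, -1} : Set ℝ), ∃ u : ℤ × ℤ,
        X₀ + t • ((n : ℝ), (m : ℝ)) =
          ε • (X₀ + s • ((n : ℝ), (m : ℝ))) + ((u.1 : ℝ), (u.2 : ℝ))) →
      s = t := by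
  rintro s ⟨hs₀, hs₁⟩ t ⟨ht₀, ht₁⟩ ⟨ε, hε, ⟨u, v⟩, h⟩
  obtain ⟨h₁, h₂⟩ := Prod.ext_iff.mp h
  simp only [Prod.fst_add, Prod.snd_add, Prod.smul_fst, Prod.smul_snd, smul_eq_mul] at h₁ h₂
  rcases hε with rfl | rfl
  · obtain ⟨a, b, hab⟩ := hco
    have hab' : (a : ℝ) * n + b * m = 1 := mod_cast hab
    have hts : t - s = ((a * u + b * v : ℤ) : ℝ) := by
      push_cast
      linear_combination (s - t) * hab' + a * h₁ + b * h₂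
    have hzero : a * u + b * v = 0 := by
      rw [← Int.abs_lt_one_iff]
      have : |((a * u + b * v : ℤ) : ℝ)| < 1 := by
        rw [← hts, abs_lt]
        constructor <;> linarith
      exact_mod_cast this
    rw [hzero, Int.cast_zero] at hts
    linarith
  · -- The midpoint of the two identified points is fixed by the identification, hence a knot.
    refine absurd ⟨⟨u, ?_⟩, ⟨v, ?_⟩⟩ (hline ((s + t) / 2)) <;>
      simp only [Prod.fst_add, Prod.snd_add, Prod.smul_fst, Prod.smul_snd, smul_eq_mul] <;>
      linarith
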